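/- The sequence of vectors n ↦ (c_1·c_3·⋯·c_{2n−1})^{−1} · (P_1·P_3·⋯·P_{2n−1}) e₉ converges in ℝ⁹, as n → ∞, to a nonzero vector. -/

import Mathlib

open Filter Finset Matrix

/-- The golden ratio φ = (1+√5)/2. -/
noncomputable def goldphi : ℝ := (1 + Real.sqrt 5) / 2

/-- The matrix `A`: identity in rows 1–7, row 8 = (0,0,0,0,0,1,1,1,1),
row 9 = (0,0,0,1,1,2,0,1,2). -/
def Amat : Matrix (Fin 9) (Fin 9) ℝ :=
  !![1,0,0,0,0,0,0,0,0;
     0,1,0,0,0,0,0,0,0;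
     0,0,1,0,0,0,0,0,0;
     0,0,0,1,0,0,0,0,0;
     0,0,0,0,1,0,0,0,0;
     0,0,0,0,0,1,0,0,0;
     0,0,0,0,0,0,1,0,0;
     0,0,0,0,0,1,1,1,1;
     0,0,0,1,1,2,0,1,2]

/-- The matrix `M` with rows e₆, e₉, e₈, e₂, e₄+e₅, e₇, e₁+e₃, e₃, e₄. -/
def Mmat : Matrix (Fin 9) (Fin 9) ℝ :=
  !![0,0,0,0,0,1,0,0,0;
     0,0,0,0,0,0,0,0,1;
     0,0,0,0,0,0,0,1,0;
     0,1,0,0,0,0,0,0,0;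
     0,0,0,1,1,0,0,0,0;
     0,0,0,0,0,0,1,0,0;
     1,0,1,0,0,0,0,0,0;
     0,0,1,0,0,0,0,0,0;
     0,0,0,1,0,0,0,0,0]

/-- The rank-one limit matrix `L`, nonzero only in rows 2 and 3. -/
noncomputable def Lmat : Matrix (Fin 9) (Fin 9) ℝ :=
  !![0,0,0,0,0,0,0,0,0;
     (Real.sqrt 5 - 1)/4, 1/2, (1 + Real.sqrt 5)/4, (3 + Real.sqrt 5)/4, 1/2, 0, (3 + Real.sqrt 5)/4, 0, 0;
     (3 - Real.sqrt 5)/4, (Real.sqrt 5 - 1)/4, 1/2, (1 + Real.sqrt 5)/4, (Real.sqrt 5 - 1)/4, 0, (1 + Real.sqrt 5)/4, 0, 0;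
     0,0,0,0,0,0,0,0,0;
     0,0,0,0,0,0,0,0,0;
     0,0,0,0,0,0,0,0,0;
     0,0,0,0,0,0,0,0,0;
     0,0,0,0,0,0,0,0,0;
     0,0,0,0,0,0,0,0,0]

/-- `a_i = r_i - 1`. -/
def aseq (r : ℕ → ℕ) (i : ℕ) : ℕ := r i - 1

/-- `c_i = (2/√5)·φ^{2 a_i}`. -/
noncomputable def cseq (r : ℕ → ℕ) (i : ℕ) : ℝ :=
  (2 / Real.sqrt 5) * goldphi ^ (2 * aseq r i)

/-- `P_i = A^{a_i} M A^{a_{i+1}} M`. -/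
noncomputable def Pmat (r : ℕ → ℕ) (i : ℕ) : Matrix (Fin 9) (Fin 9) ℝ :=
  Amat ^ (aseq r i) * Mmat * Amat ^ (aseq r (i+1)) * Mmat

/-- `R_i = P_i / c_{i+1}`. -/
noncomputable def Rmat (r : ℕ → ℕ) (i : ℕ) : Matrix (Fin 9) (Fin 9) ℝ :=
  (cseq r (i+1))⁻¹ • Pmat r i

/-- The Frobenius norm of a square real matrix. -/
noncomputable def frobNorm {n : ℕ} (X : Matrix (Fin n) (Fin n) ℝ) : ℝ :=
  Real.sqrt (∑ i, ∑ j, (X i j)^2)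

/-- The hypotheses on the sequence `r`: `r 1 = 1`, `r 2 = 2`, and the sequence of
differences `n ↦ r (n+1) - r n` (for `n ≥ 1`) is strictly increasing. -/
def GoodSeq (r : ℕ → ℕ) : Prop :=
  r 1 = 1 ∧ r 2 = 2 ∧ ∀ n, 1 ≤ n → r (n+1) - r n < r (n+2) - r (n+1)


/-- Explicit form of the powers of `A`, with `p = F_{2n}`, `q = F_{2n+1}`. -/
def Aexp (p q : ℝ) : Matrix (Fin 9) (Fin 9) ℝ :=
  !![1,0,0,0,0,0,0,0,0;
     0,1,0,0,0,0,0,0,0;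
     0,0,1,0,0,0,0,0,0;
     0,0,0,1,0,0,0,0,0;
     0,0,0,0,1,0,0,0,0;
     0,0,0,0,0,1,0,0,0;
     0,0,0,0,0,0,1,0,0;
     0,0,0,q-p-1,q-p-1,q-1,1+2*p-q,q-p,p;
     0,0,0,p,p,q+p-1,q-p-1,p,q]

lemma goldphi_sq : goldphi ^ 2 = goldphi + 1 := by
  have h : Real.sqrt 5 ^ 2 = 5 := Real.sq_sqrt (by norm_num)
  unfold goldphi
  nlinarith

lemma goldphi_bounds : 1.6 < goldphi ∧ goldphi < 1.7 := by
  have h : Real.sqrt 5 ^ 2 = 5 := Real.sq_sqrt (by norm_num)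
  have h0 : 0 ≤ Real.sqrt 5 := Real.sqrt_nonneg 5
  unfold goldphi
  constructor <;> norm_num <;> nlinarith

lemma vecMul_Aexp (p q : ℝ) (y : Fin 9 → ℝ) :
    y ᵥ* Aexp p q = ![y 0, y 1, y 2, y 3 + (q-p-1) * y 7 + p * y 8,
      y 4 + (q-p-1) * y 7 + p * y 8, y 5 + (q-1) * y 7 + (q+p-1) * y 8,
      y 6 + (1+2*p-q) * y 7 + (q-p-1) * y 8, (q-p) * y 7 + p * y 8, p * y 7 + q * y 8] := by
  ext j
  fin_cases j <;> simp [Matrix.vecMul, dotProduct, Fin.sum_univ_succ, Aexp] <;> ring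

lemma vecMul_Mmat (y : Fin 9 → ℝ) :
    y ᵥ* Mmat = ![y 6, y 3, y 6 + y 7, y 4 + y 8, y 4, y 0, y 5, y 2, y 1] := by
  ext j
  fin_cases j <;> simp [Matrix.vecMul, dotProduct, Fin.sum_univ_succ, Mmat]

lemma vecMul_Amat (y : Fin 9 → ℝ) :
    y ᵥ* Amat = ![y 0, y 1, y 2, y 3 + y 8, y 4 + y 8, y 5 + y 7 + 2 * y 8,
      y 6 + y 7, y 7 + y 8, y 7 + 2 * y 8] := by
  ext j
  fin_cases j <;> simp [Matrix.vecMul, dotProduct, Fin.sum_univ_succ, Amat] <;> ring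

/-- Powers of `A` act through `Aexp`, and the two parameters satisfy the Binet relations. -/
lemma Amat_pow (n : ℕ) : ∃ p q : ℝ, (∀ y : Fin 9 → ℝ, y ᵥ* Amat ^ n = y ᵥ* Aexp p q) ∧
    0 ≤ p ∧ p + 1 ≤ q ∧ q ≤ 2 * p + 1 ∧
    goldphi * q + p = goldphi * goldphi ^ (2 * n) ∧
    (q - goldphi * p) * goldphi ^ (2 * n) = 1 := by
  induction n with
  | zero =>
    refine ⟨0, 1, ?_, by norm_num, by norm_num, by norm_num, by simp, by simp⟩
    intro y
    rw [vecMul_Aexp]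
    ext j
    fin_cases j <;> simp
  | succ n ih =>
    obtain ⟨p, q, h, h0, h1, h2, h3, h4⟩ := ih
    have hg := goldphi_sq
    refine ⟨p + q, p + 2 * q, ?_, by linarith, by linarith, by linarith, ?_, ?_⟩
    · intro y
      rw [pow_succ, ← Matrix.vecMul_vecMul, h, vecMul_Amat, vecMul_Aexp, vecMul_Aexp]
      ext j
      fin_cases j <;> simp <;> ring
    · have : goldphi ^ (2 * (n+1)) = goldphi ^ (2*n) * (goldphi + 1) := by
        rw [← hg]; ring
      rw [this, ← mul_assoc, ← h3]
      linear_combination (-q) * hg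
    · have : goldphi ^ (2 * (n+1)) = goldphi ^ (2*n) * (goldphi + 1) := by
        rw [← hg]; ring
      rw [this]
      have e : (p + 2 * q - goldphi * (p + q)) * (goldphi + 1) = q - goldphi * p := by
        linear_combination (-p - q) * hg
      linear_combination h4 + goldphi ^ (2*n) * e

/-- The sum of the first seven coordinates. -/
def low (y : Fin 9 → ℝ) : ℝ := y 0 + y 1 + y 2 + y 3 + y 4 + y 5 + y 6

/-- The linear functional that is asymptotically preserved. -/
noncomputable def zed (y : Fin 9 → ℝ) : ℝ := y 7 + goldphi * y 8

lemma step_explicit (p q p' q' : ℝ) (y : Fin 9 → ℝ) :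
    ∃ v4 v5 v6 v7 v8 v9 : ℝ,
      v4 = y 3 + (q-p-1) * y 7 + p * y 8 ∧
      v5 = y 4 + (q-p-1) * y 7 + p * y 8 ∧
      v6 = y 5 + (q-1) * y 7 + (q+p-1) * y 8 ∧
      v7 = y 6 + (1+2*p-q) * y 7 + (q-p-1) * y 8 ∧
      v8 = (q-p) * y 7 + p * y 8 ∧ v9 = p * y 7 + q * y 8 ∧
      (((y ᵥ* Aexp p q) ᵥ* Mmat) ᵥ* Aexp p' q') ᵥ* Mmat =
      ![v6 + (1+2*p'-q') * y 2 + (q'-p'-1) * y 1,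
        v5 + v9 + (q'-p'-1) * y 2 + p' * y 1,
        v6 + (1+2*p'-q') * y 2 + (q'-p'-1) * y 1 + ((q'-p') * y 2 + p' * y 1),
        v5 + (q'-p'-1) * y 2 + p' * y 1 + (p' * y 2 + q' * y 1),
        v5 + (q'-p'-1) * y 2 + p' * y 1,
        v7,
        y 0 + (q'-1) * y 2 + (q'+p'-1) * y 1,
        v7 + v8, v4] := by
  refine ⟨_, _, _, _, _, _, rfl, rfl, rfl, rfl, rfl, rfl, ?_⟩
  rw [vecMul_Aexp, vecMul_Mmat, vecMul_Aexp, vecMul_Mmat]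
  ext j
  fin_cases j <;> simp

lemma two_div_sqrt : (2 / Real.sqrt 5) * (2 * goldphi - 1) = 2 := by
  have : Real.sqrt 5 ≠ 0 := by positivity
  unfold goldphi
  field_simp
  ring

lemma scalar_facts {g s F p q : ℝ} (hg : g ^ 2 = g + 1) (hg1 : 1.6 < g) (hg2 : g < 1.7)
    (hs : s * (2 * g - 1) = 2) (hF : 1 ≤ F) (h0 : 0 ≤ p) (h3 : g * q + p = g * F)
    (h4 : (q - g * p) * F = 1) :
    0.8 < s ∧ s < 1 ∧ q ≤ F ∧ ∃ w, 0 ≤ s * w ∧ s * w ≤ 1 ∧ 0 ≤ s * g * w ∧ s * g * w ≤ 1.7 ∧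
      p + g * (q - p) = s * F + s * g * w / 2 ∧
      q + g * p = g * (s * F) - s * w / 2 ∧
      q - p = s * F * ((g - 1) / 2) + s * g * w / 2 ∧
      p = s * F / 2 - s * w / 2 := by
  have e1 : s = (4 * g - 2) / 5 := by
    have : (2 * g - 1) ^ 2 = 5 := by linear_combination 4 * hg
    linear_combination (-s / 5) * this + (2 * g - 1) / 5 * hs
  have e2 : F = q + p * (g - 1) := by
    have : g ≠ 0 := by linarith
    apply mul_left_cancel₀ this
    linear_combination -h3 - p * hg
  have hs0 : 0.8 < s := by norm_num at *; linarith
  have hs1 : s < 1 := by norm_num at *; linarith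
  have hqF : q ≤ F := by
    have : 0 ≤ p * (g - 1) := mul_nonneg h0 (by linarith)
    linarith
  obtain ⟨w, hw⟩ : ∃ w, w = q - g * p := ⟨_, rfl⟩
  rw [← hw] at h4
  have hw0 : 0 < w := by
    by_contra hcon
    nlinarith
  have hw1 : w ≤ 1 := by nlinarith
  have hsw1 : s * w ≤ 1 := by nlinarith
  have hsw0 : 0 ≤ s * w := mul_nonneg (by linarith) hw0.le
  refine ⟨hs0, hs1, hqF, w, hsw0, hsw1, ?_, ?_, ?_, ?_, ?_, ?_⟩
  · rw [mul_right_comm]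
    exact mul_nonneg hsw0 (by linarith)
  · rw [mul_right_comm]
    nlinarith
  · rw [e1, e2, hw]
    linear_combination (-2/5 * q + p * (2 * g - 3) / 5) * hg
  · rw [e1, e2, hw]
    linear_combination (-4/5 * (q + g * p)) * hg
  · rw [e1, e2, hw]
    linear_combination (-4/5 * (q - p)) * hg
  · rw [e1, e2, hw]
    linear_combination (-4/5 * p) * hg

set_option maxHeartbeats 2000000 in
lemma step_bounds (r : ℕ → ℕ) (i : ℕ) (y y' : Fin 9 → ℝ) (hy : ∀ j, 0 ≤ y j)
    (hy' : y' = (cseq r i)⁻¹ • (y ᵥ* Pmat r i)) :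
    (∀ j, 0 ≤ y' j) ∧
    goldphi ^ (2 * aseq r i) * low y' ≤
      100 * (goldphi ^ (2 * aseq r (i+1)) * low y + goldphi ^ (2 * aseq r i) * zed y) ∧
    goldphi ^ (2 * aseq r i) * |zed y' - zed y| ≤ 100 * (low y + zed y) ∧
    goldphi ^ (2 * aseq r i) * |y' 8 - zed y / (2 * goldphi)| ≤ 100 * (low y + zed y) ∧
    (1 - (cseq r i)⁻¹) * zed y ≤ zed y' := by
  obtain ⟨p, q, h, h0, h1, h2, h3, h4⟩ := Amat_pow (aseq r i)
  obtain ⟨p', q', k, k0, k1, k2, k3, k4⟩ := Amat_pow (aseq r (i+1))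
  obtain ⟨v4, v5, v6, v7, v8, v9, e4, e5, e6, e7, e8, e9, hs⟩ := step_explicit p q p' q' y
  have hP : y ᵥ* Pmat r i = (((y ᵥ* Aexp p q) ᵥ* Mmat) ᵥ* Aexp p' q') ᵥ* Mmat := by
    unfold Pmat
    rw [← Matrix.vecMul_vecMul, ← Matrix.vecMul_vecMul, ← Matrix.vecMul_vecMul, h, k]
  rw [hP, hs] at hy'
  clear hP hs h k
  have hg := goldphi_sq
  obtain ⟨hg1, hg2⟩ := goldphi_bounds
  have hs := two_div_sqrt
  unfold cseq at hy' ⊢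
  unfold zed
  have hF : 1 ≤ goldphi ^ (2 * aseq r i) := one_le_pow₀ (by linarith)
  have hF' : 1 ≤ goldphi ^ (2 * aseq r (i+1)) := one_le_pow₀ (by linarith)
  generalize goldphi ^ (2 * aseq r i) = F at *
  generalize goldphi ^ (2 * aseq r (i+1)) = F' at *
  generalize 2 / Real.sqrt 5 = s at *
  generalize goldphi = g at *
  obtain ⟨hs0, hs1, hqF, hsc⟩ := scalar_facts hg hg1 hg2 hs hF h0 h3 h4
  obtain ⟨-, -, hqF', -⟩ := scalar_facts hg hg1 hg2 hs hF' k0 k3 k4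
  have hc : 0 < s * F := mul_pos (by linarith) (by linarith)
  have hci : 0 < (s * F)⁻¹ := inv_pos.mpr hc
  have hFc : F * (s * F)⁻¹ = s⁻¹ := by
    have : s ≠ 0 := by linarith
    have : F ≠ 0 := by linarith
    field_simp
  have hsi : s⁻¹ ≤ 1.25 := by
    rw [inv_le_comm₀ (by linarith) (by norm_num)]; norm_num; linarith
  have hsi0 : 0 < s⁻¹ := inv_pos.mpr (by linarith)
  have y0 := hy 0
  have y1 := hy 1
  have y2 := hy 2
  have y3 := hy 3
  have y4 := hy 4
  have y5 := hy 5
  have y6 := hy 6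
  have y7 := hy 7
  have y8 := hy 8
  have a1 := mul_nonneg h0 y7
  have a2 := mul_nonneg h0 y8
  have a3 := mul_nonneg (sub_nonneg.mpr h1) y7
  have a4 := mul_nonneg (sub_nonneg.mpr h1) y8
  have a5 := mul_nonneg (sub_nonneg.mpr h2) y7
  have a6 := mul_nonneg (sub_nonneg.mpr hqF) y7
  have a7 := mul_nonneg (sub_nonneg.mpr hqF) y8
  have b1 := mul_nonneg k0 y1
  have b2 := mul_nonneg k0 y2
  have b3 := mul_nonneg (sub_nonneg.mpr k1) y1
  have b4 := mul_nonneg (sub_nonneg.mpr k1) y2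
  have b5 := mul_nonneg (sub_nonneg.mpr k2) y2
  have b6 := mul_nonneg (sub_nonneg.mpr hqF') y1
  have b7 := mul_nonneg (sub_nonneg.mpr hqF') y2
  refine ⟨?_, ?_, ?_⟩
  · intro j
    rw [hy', Pi.smul_apply, smul_eq_mul]
    apply mul_nonneg hci.le
    fin_cases j <;> simp <;> linarith
  · have hL : F * low y' = s⁻¹ * low ((s * F) • y') := by
      rw [← hFc]
      simp only [low, Pi.smul_apply, smul_eq_mul]
      field_simp
    have hL2 : low ((s * F) • y') ≤ 50 * (F' * low y + F * (y 7 + g * y 8)) := by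
      rw [hy', smul_inv_smul₀ hc.ne']
      have t1 : 0 ≤ (F' - 1) * y 0 := mul_nonneg (by linarith) y0
      have t2 : 0 ≤ (F' - 1) * y 1 := mul_nonneg (by linarith) y1
      have t3 : 0 ≤ (F' - 1) * y 2 := mul_nonneg (by linarith) y2
      have t4 : 0 ≤ (F' - 1) * y 3 := mul_nonneg (by linarith) y3
      have t5 : 0 ≤ (F' - 1) * y 4 := mul_nonneg (by linarith) y4
      have t6 : 0 ≤ (F' - 1) * y 5 := mul_nonneg (by linarith) y5
      have t7 : 0 ≤ (F' - 1) * y 6 := mul_nonneg (by linarith) y6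
      have t8 : 0 ≤ (F - 1) * y 7 := mul_nonneg (by linarith) y7
      have t9 : 0 ≤ (F - 1) * y 8 := mul_nonneg (by linarith) y8
      have t10 : 0 ≤ (g - 1) * (F * y 8) := mul_nonneg (by linarith) (by positivity)
      simp [low]
      linarith
    have hN : 0 ≤ F' * low y + F * (y 7 + g * y 8) := by
      have : 0 ≤ low y := by unfold low; linarith
      positivity
    rw [hL]
    calc s⁻¹ * low ((s * F) • y') ≤ s⁻¹ * (50 * (F' * low y + F * (y 7 + g * y 8))) :=
          mul_le_mul_of_nonneg_left hL2 hsi0.le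
      _ ≤ 1.25 * (50 * (F' * low y + F * (y 7 + g * y 8))) :=
          mul_le_mul_of_nonneg_right hsi (by linarith)
      _ ≤ _ := by linarith
  · obtain ⟨w, hsw0, hsw1, hgs0, hgs1, i1, i2, i3, i4⟩ := hsc
    have u7 : (s * F) * y' 7 = v7 + v8 := by
      rw [hy']; simp; field_simp
    have u8 : (s * F) * y' 8 = v4 := by
      rw [hy']; simp; field_simp
    have dz : (s * F) * (y' 7 + g * y' 8 - (y 7 + g * y 8)) =
        y 6 + g * y 3 + (s * g * w / 2 + 1 - g) * y 7 + (-(s * w) / 2 - 1) * y 8 := by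
      rw [mul_sub, mul_add, mul_left_comm, u7, u8, e7, e8, e4]
      linear_combination y 7 * i1 + y 8 * i2
    have d8 : (s * F) * (y' 8 - (y 7 + g * y 8) / (2 * g)) =
        y 3 + (s * g * w / 2 - 1) * y 7 - s * w / 2 * y 8 := by
      have : (y 7 + g * y 8) / (2 * g) = (g - 1) / 2 * y 7 + y 8 / 2 := by
        have : g ≠ 0 := by linarith
        field_simp
        linear_combination (- y 7) * hg
      rw [this, mul_sub, u8, e4]
      linear_combination y 7 * i3 + y 8 * i4
    have m1 := mul_nonneg hgs0 y7
    have m2 := mul_nonneg (sub_nonneg.mpr hgs1) y7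
    have m3 := mul_nonneg hsw0 y8
    have m4 := mul_nonneg (sub_nonneg.mpr hsw1) y8
    have m5 : 0 ≤ (g - 1.6) * y 7 := mul_nonneg (by linarith) y7
    have m6 : 0 ≤ (1.7 - g) * y 7 := mul_nonneg (by linarith) y7
    have m7 : 0 ≤ (g - 1.6) * y 8 := mul_nonneg (by linarith) y8
    have m8 : 0 ≤ (1.7 - g) * y 8 := mul_nonneg (by linarith) y8
    have m9 : 0 ≤ (g - 1.6) * y 3 := mul_nonneg (by linarith) y3
    have m10 : 0 ≤ (1.7 - g) * y 3 := mul_nonneg (by linarith) y3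
    have key : ∀ X : ℝ, |(s * F) * X| ≤ 3 * (low y + (y 7 + g * y 8)) →
        F * |X| ≤ 100 * (low y + (y 7 + g * y 8)) := by
      intro X hX
      rw [abs_mul, abs_of_pos hc] at hX
      have h5 : 0 ≤ F * |X| := mul_nonneg (by linarith) (abs_nonneg X)
      have h6 : 0.8 * (F * |X|) ≤ s * (F * |X|) := mul_le_mul_of_nonneg_right hs0.le h5
      rw [← mul_assoc s] at h6
      linarith
    refine ⟨key _ ?_, key _ ?_, ?_⟩
    · rw [dz, abs_le]
      unfold low
      constructor <;> linarith
    · rw [d8, abs_le]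
      unfold low
      constructor <;> linarith
    · have : (s * F) * ((1 - (s * F)⁻¹) * (y 7 + g * y 8)) ≤ (s * F) * (y' 7 + g * y' 8) := by
        have e : (s * F) * ((1 - (s * F)⁻¹) * (y 7 + g * y 8)) =
            (s * F) * (y 7 + g * y 8) - (y 7 + g * y 8) := by
          field_simp
        rw [e]
        linarith
      exact le_of_mul_le_mul_left this hc

lemma aseq_step (r : ℕ → ℕ) (hr : GoodSeq r) (n : ℕ) :
    aseq r (n+1) + (n+1) ≤ aseq r (n+2) := by
  obtain ⟨h1, h2, h3⟩ := hr
  have key : ∀ n, 1 ≤ r (n+1) ∧ n + 1 ≤ r (n+2) - r (n+1) := by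
    intro n
    induction n with
    | zero => simp [h1, h2]
    | succ n ih =>
      have := h3 (n+1) (by omega)
      simp only [add_assoc] at this ih ⊢
      norm_num at this ih ⊢
      omega
  have := key n
  have := key (n+1)
  unfold aseq
  simp only [add_assoc] at *
  norm_num at *
  omega

lemma aseq_lower (r : ℕ → ℕ) (hr : GoodSeq r) (n : ℕ) : 3 * n ≤ aseq r (2*n+1) := by
  induction n with
  | zero => simp
  | succ n ih =>
    have h1 := aseq_step r hr (2*n)
    have h2 := aseq_step r hr (2*n+1)
    have e : 2 * (n+1) + 1 = 2*n+1+2 := by ring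
    rw [e]
    simp only [add_assoc] at *
    norm_num at *
    omega

lemma bounded_of_growth (m : ℕ → ℝ) (C t : ℝ) (hC : 0 ≤ C) (ht : 0 ≤ t) (ht1 : t < 1)
    (hm : ∀ n, 0 ≤ m n) (h : ∀ n, m (n+1) ≤ m n * (1 + C * t ^ n)) :
    ∃ B, 0 ≤ B ∧ ∀ n, m n ≤ B := by
  have h1 : ∀ n, m n ≤ m 0 * Real.exp (C * ∑ k ∈ Finset.range n, t ^ k) := by
    intro n
    induction n with
    | zero => simp
    | succ n ih =>
      rw [Finset.sum_range_succ, mul_add, Real.exp_add, ← mul_assoc]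
      refine (h n).trans (mul_le_mul ih ?_ (by positivity) ?_)
      · linarith [Real.add_one_le_exp (C * t ^ n)]
      · exact mul_nonneg (hm 0) (Real.exp_pos _).le
  refine ⟨m 0 * Real.exp (C * (1 - t)⁻¹), mul_nonneg (hm 0) (Real.exp_pos _).le, fun n => (h1 n).trans ?_⟩
  apply mul_le_mul_of_nonneg_left _ (hm 0)
  apply Real.exp_le_exp.mpr
  apply mul_le_mul_of_nonneg_left _ hC
  rw [← tsum_geometric_of_lt_one ht ht1]
  exact (summable_geometric_of_lt_one ht ht1).sum_le_tsum _ (fun i _ => by positivity)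

lemma row_converges (r : ℕ → ℕ) (hr : GoodSeq r) (y : ℕ → Fin 9 → ℝ) (hy0 : ∀ j, 0 ≤ y 0 j)
    (hy : ∀ n, y (n+1) = (cseq r (2*n+1))⁻¹ • (y n ᵥ* Pmat r (2*n+1))) :
    ∃ Z, Tendsto (fun n => y n 8) atTop (nhds (Z / (2 * goldphi))) ∧
      (0 < zed (y 1) → 0 < Z) := by
  obtain ⟨hg1, hg2⟩ := goldphi_bounds
  have hg := goldphi_sq
  have hg0 : 0 < goldphi := by linarith
  have hnn : ∀ n j, 0 ≤ y n j := by
    intro n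
    induction n with
    | zero => exact hy0
    | succ n ih => exact (step_bounds r (2*n+1) (y n) (y (n+1)) ih (hy n)).1
  have hb := fun n => (step_bounds r (2*n+1) (y n) (y (n+1)) (hnn n) (hy n)).2
  have hlow : ∀ n, 0 ≤ low (y n) := by
    intro n
    unfold low
    linarith [hnn n 0, hnn n 1, hnn n 2, hnn n 3, hnn n 4, hnn n 5, hnn n 6]
  have hzed : ∀ n, 0 ≤ zed (y n) := by
    intro n
    have := hnn n 7
    have := hnn n 8
    unfold zed
    positivity
  obtain ⟨F, hF⟩ : ∃ F : ℕ → ℝ, ∀ n, goldphi ^ (2 * aseq r (2*n+1)) = F n := ⟨_, fun n => rfl⟩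
  obtain ⟨G, hG⟩ : ∃ G : ℕ → ℝ, ∀ n, goldphi ^ (2 * aseq r (2*n+1+1)) = G n := ⟨_, fun n => rfl⟩
  simp only [hF, hG] at hb
  obtain ⟨t, ht⟩ : ∃ t, t = goldphi⁻¹ := ⟨_, rfl⟩
  have ht0 : 0 < t := by rw [ht]; positivity
  have ht1 : t < 1 := by rw [ht]; exact inv_lt_one_of_one_lt₀ (by linarith)
  have htg : ∀ n : ℕ, t ^ n * goldphi ^ n = 1 := by
    intro n
    rw [← mul_pow, ht, inv_mul_cancel₀ hg0.ne', one_pow]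
  have hF0 : ∀ n, 0 < F n := fun n => by rw [← hF]; positivity
  have hG1 : ∀ n, 1 ≤ G n := fun n => by rw [← hG]; exact one_le_pow₀ (by linarith)
  have hFt : ∀ n, (F n)⁻¹ ≤ t ^ n := by
    intro n
    rw [ht, inv_pow]
    apply inv_anti₀ (by positivity)
    rw [← hF]
    apply pow_le_pow_right₀ (by linarith)
    have := aseq_lower r hr n
    omega
  have hFG : ∀ n, goldphi ^ (2*n+1) * G n ≤ F (n+1) := by
    intro n
    rw [← hF, ← hG, ← pow_add]
    apply pow_le_pow_right₀ (by linarith)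
    have := aseq_step r hr (2*n+1)
    have e : 2 * (n+1) + 1 = 2*n+1+2 := by ring
    rw [e]
    omega
  obtain ⟨w, hw⟩ : ∃ w : ℕ → ℝ, ∀ n, w n = goldphi ^ n / F n := ⟨_, fun n => rfl⟩
  have hw0 : ∀ n, 0 < w n := fun n => by rw [hw]; exact div_pos (by positivity) (hF0 n)
  have hwF : ∀ n, (F n)⁻¹ = t ^ n * w n := by
    intro n
    rw [hw, ← mul_div_assoc, htg, one_div]
  have hwG : ∀ n, w (n+1) * G n ≤ t ^ n := by
    intro n
    rw [hw, div_mul_eq_mul_div, div_le_iff₀ (hF0 _)]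
    calc goldphi ^ (n+1) * G n = t ^ n * (goldphi ^ (2*n+1) * G n) := by
          have := htg n
          have e : goldphi ^ (2*n+1) = goldphi ^ n * goldphi ^ (n+1) := by ring
          rw [e, ← mul_assoc, ← mul_assoc, this, one_mul]
      _ ≤ _ := mul_le_mul_of_nonneg_left (hFG n) (by positivity)
  have hw1 : ∀ n, w (n+1) ≤ t ^ n := fun n =>
    (le_mul_of_one_le_right (hw0 _).le (hG1 n)).trans (hwG n)
  obtain ⟨m, hm⟩ : ∃ m : ℕ → ℝ, ∀ n, m n = zed (y n) + w n * low (y n) := ⟨_, fun n => rfl⟩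
  have hm0 : ∀ n, 0 ≤ m n := fun n => by
    rw [hm]; exact add_nonneg (hzed n) (mul_nonneg (hw0 n).le (hlow n))
  have hdiv : ∀ n, ∀ X : ℝ, F n * X ≤ 100 * (low (y n) + zed (y n)) → X ≤ 100 * t ^ n * m n := by
    intro n X hX
    have h1 : X ≤ (F n)⁻¹ * (100 * (low (y n) + zed (y n))) := by
      rw [inv_mul_eq_div, le_div_iff₀ (hF0 n)]; linarith
    have h2 : (F n)⁻¹ * low (y n) = t ^ n * (w n * low (y n)) := by rw [hwF]; ring
    have h3 : (F n)⁻¹ * zed (y n) ≤ t ^ n * zed (y n) :=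
      mul_le_mul_of_nonneg_right (hFt n) (hzed n)
    rw [hm]
    linarith
  have hdz : ∀ n, |zed (y (n+1)) - zed (y n)| ≤ 100 * t ^ n * m n := fun n =>
    hdiv n _ (hb n).2.1
  have hd8 : ∀ n, |y (n+1) 8 - zed (y n) / (2 * goldphi)| ≤ 100 * t ^ n * m n := fun n =>
    hdiv n _ (hb n).2.2.1
  have hlowstep : ∀ n, w (n+1) * low (y (n+1)) ≤ 100 * t ^ n * m n := by
    intro n
    have h1 : low (y (n+1)) ≤ 100 * ((F n)⁻¹ * G n * low (y n) + zed (y n)) := by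
      have h2 : low (y (n+1)) ≤ (F n)⁻¹ * (100 * (G n * low (y n) + F n * zed (y n))) := by
        rw [inv_mul_eq_div, le_div_iff₀ (hF0 n)]; linarith [(hb n).1]
      refine h2.trans (le_of_eq ?_)
      have := (hF0 n).ne'
      field_simp
    have h3 : w (n+1) * low (y (n+1)) ≤
        w (n+1) * (100 * ((F n)⁻¹ * G n * low (y n) + zed (y n))) :=
      mul_le_mul_of_nonneg_left h1 (hw0 _).le
    have h4 : w (n+1) * zed (y n) ≤ t ^ n * zed (y n) :=
      mul_le_mul_of_nonneg_right (hw1 n) (hzed n)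
    have h5 : (w (n+1) * G n) * ((F n)⁻¹ * low (y n)) ≤ t ^ n * (w n * low (y n)) := by
      apply mul_le_mul (hwG n) _ _ (by positivity)
      · apply mul_le_mul_of_nonneg_right _ (hlow n)
        rw [hwF]
        exact mul_le_of_le_one_left (hw0 n).le (pow_le_one₀ ht0.le ht1.le)
      · exact mul_nonneg (inv_pos.mpr (hF0 n)).le (hlow n)
    rw [hm]
    linarith
  obtain ⟨B, hB0, hB⟩ := bounded_of_growth m 200 t (by norm_num) ht0.le ht1 hm0 (by
    intro n
    have h1 := (abs_le.mp (hdz n)).2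
    have h2 := hlowstep n
    have h3 : zed (y n) ≤ m n := by
      rw [hm n]
      linarith [mul_nonneg (hw0 n).le (hlow n)]
    rw [hm (n+1)]
    linarith)
  have hbd : ∀ n, 100 * t ^ n * m n ≤ 100 * B * t ^ n := by
    intro n
    have : 100 * t ^ n * m n ≤ 100 * t ^ n * B :=
      mul_le_mul_of_nonneg_left (hB n) (by positivity)
    linarith
  have hcau : CauchySeq (fun n => zed (y n)) := by
    apply cauchySeq_of_le_geometric t (100 * B) ht1
    intro n
    rw [dist_comm, Real.dist_eq]
    exact (hdz n).trans (hbd n)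
  obtain ⟨Z, hZ⟩ := cauchySeq_tendsto_of_complete hcau
  refine ⟨Z, ?_, ?_⟩
  · rw [← tendsto_add_atTop_iff_nat 1]
    have h0 : Tendsto (fun n => y (n+1) 8 - zed (y n) / (2 * goldphi)) atTop (nhds 0) := by
      apply squeeze_zero_norm (a := fun n => 100 * B * t ^ n)
      · intro n
        exact (hd8 n).trans (hbd n)
      · simpa using (tendsto_pow_atTop_nhds_zero_of_lt_one ht0.le ht1).const_mul (100 * B)
    have := h0.add (hZ.div_const (2 * goldphi))
    simpa using this
  · intro hpos
    have hc : ∀ n : ℕ, (cseq r (2*(n+1)+1))⁻¹ ≤ (1/8 : ℝ) ^ (n+1) := by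
      intro n
      have h2 := two_div_sqrt
      have hs : 0.8 ≤ 2 / Real.sqrt 5 := by nlinarith
      have h6 : goldphi ^ 6 = 8 * goldphi + 5 := by
        linear_combination (goldphi ^ 4 + goldphi ^ 3 + 2 * goldphi ^ 2 + 3 * goldphi + 5) * hg
      have h7 : (16 : ℝ) ^ (n+1) ≤ goldphi ^ (2 * aseq r (2*(n+1)+1)) := by
        calc (16 : ℝ) ^ (n+1) ≤ (goldphi ^ 6) ^ (n+1) := by
              apply pow_le_pow_left₀ (by norm_num)
              linarith
          _ = goldphi ^ (6 * (n+1)) := by rw [← pow_mul]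
          _ ≤ _ := by
            apply pow_le_pow_right₀ (by linarith)
            have := aseq_lower r hr (n+1)
            omega
      rw [one_div, inv_pow]
      apply inv_anti₀ (by positivity)
      unfold cseq
      have h8 : (16 : ℝ) ^ (n+1) = 2 * 2 ^ n * 8 ^ (n+1) := by
        rw [show (16:ℝ) = 2 * 8 by norm_num, mul_pow, pow_succ]; ring
      have h9 : (1 : ℝ) ≤ 2 ^ n := one_le_pow₀ (by norm_num)
      have h10 : (0 : ℝ) < 8 ^ (n+1) := by positivity
      have h11 : (8 : ℝ) ^ (n+1) ≤ 2 ^ n * 8 ^ (n+1) := le_mul_of_one_le_left h10.le h9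
      calc (8 : ℝ) ^ (n+1) ≤ 0.8 * 16 ^ (n+1) := by rw [h8]; linarith
        _ ≤ _ := mul_le_mul hs h7 (by positivity) (by linarith)
    have hlb : ∀ n : ℕ, zed (y 1) / 2 * (1 + (1/2) ^ n) ≤ zed (y (n+1)) := by
      intro n
      induction n with
      | zero => norm_num
      | succ n ih =>
        refine le_trans ?_ (hb (n+1)).2.2.2
        have h1 := hc n
        have h2 : (1/8 : ℝ) ^ (n+1) = ((1/2) ^ (n+1)) ^ 3 := by
          rw [← pow_mul, mul_comm, pow_mul]; norm_num
        have h3 : (1/2 : ℝ) ^ n = 2 * (1/2) ^ (n+1) := by rw [pow_succ]; ring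
        have h4 : (1/2 : ℝ) ^ (n+1) ≤ 1/2 := by
          rw [pow_succ]
          have : (1/2 : ℝ) ^ n ≤ 1 := pow_le_one₀ (by norm_num) (by norm_num)
          linarith
        have h5 : (0 : ℝ) < (1/2) ^ (n+1) := by positivity
        rw [h2] at h1
        rw [h3] at ih
        generalize (1/2 : ℝ) ^ (n+1) = x at *
        have h6 : x ^ 2 ≤ 1/4 := by nlinarith
        have h7 : x ^ 3 ≤ 1/4 * x := by nlinarith
        have h8 : 0 ≤ 1 - (cseq r (2*(n+1)+1))⁻¹ - (1 - 1/4 * x) := by linarith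
        calc zed (y 1) / 2 * (1 + x) ≤ (1 - 1/4 * x) * (zed (y 1) / 2 * (1 + 2 * x)) := by
              have : (1 + x) ≤ (1 - 1/4 * x) * (1 + 2 * x) := by nlinarith
              nlinarith
          _ ≤ (1 - 1/4 * x) * zed (y (n+1)) := mul_le_mul_of_nonneg_left ih (by linarith)
          _ ≤ _ := mul_le_mul_of_nonneg_right (by linarith) (hzed _)
    have : zed (y 1) / 2 ≤ Z := by
      apply ge_of_tendsto hZ
      filter_upwards [Filter.eventually_ge_atTop 1] with n hn
      obtain ⟨k, rfl⟩ : ∃ k, n = k + 1 := ⟨n - 1, by omega⟩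
      refine le_trans ?_ (hlb k)
      have : (0:ℝ) < (1/2) ^ k := by positivity
      nlinarith
    linarith

/-- `(c_1 c_3 ⋯ c_{2n−1})⁻¹ (P_1 P_3 ⋯ P_{2n−1}) e₉` converges to a nonzero vector. -/
theorem stmt7 (r : ℕ → ℕ) (hr : GoodSeq r) :
    ∃ v : Fin 9 → ℝ, v ≠ 0 ∧
      Tendsto
        (fun n => (∏ l ∈ Finset.range n, cseq r (2*l+1))⁻¹ •
          (((List.range n).map (fun l => Pmat r (2*l+1))).prod).mulVec
            (Pi.single (8 : Fin 9) (1 : ℝ)))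
        atTop (nhds v) := by
  obtain ⟨Q, hQ⟩ : ∃ Q : ℕ → Matrix (Fin 9) (Fin 9) ℝ, ∀ n,
      Q n = (∏ l ∈ Finset.range n, cseq r (2*l+1))⁻¹ •
        ((List.range n).map (fun l => Pmat r (2*l+1))).prod := ⟨_, fun n => rfl⟩
  have hQ0 : Q 0 = 1 := by simp [hQ]
  have hQs : ∀ n, Q (n+1) = (cseq r (2*n+1))⁻¹ • (Q n * Pmat r (2*n+1)) := by
    intro n
    rw [hQ, hQ, List.range_succ, List.map_append, List.prod_append, Finset.prod_range_succ,
      Matrix.smul_mul, smul_smul, mul_inv, mul_comm (cseq r (2*n+1))⁻¹]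
    simp
  have hrow : ∀ k : Fin 9, ∃ Z, Tendsto (fun n => Q n k 8) atTop (nhds (Z / (2 * goldphi))) ∧
      (0 < zed (Q 1 k) → 0 < Z) := by
    intro k
    apply row_converges r hr (fun n => Q n k)
    · intro j
      simp only [hQ0, Matrix.one_apply]
      split_ifs <;> norm_num
    · intro n
      ext j
      simp [hQs, Matrix.mul_apply, Matrix.vecMul, dotProduct]
  choose Z hZ hpos using hrow
  have hg := goldphi_bounds.1
  refine ⟨fun k => Z k / (2 * goldphi), ?_, ?_⟩
  · intro h0
    have h1 := congrFun h0 7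
    have h2 : 0 < Z 7 := by
      apply hpos
      have ha : aseq r 1 = 0 := by simp [aseq, hr.1]
      have hc : 0 < cseq r 1 := by
        have : 0 < goldphi := by linarith
        unfold cseq
        positivity
      have hci := inv_pos.mpr hc
      have hb := step_bounds r 1 (Q 0 7) (Q 1 7) (by
        intro j
        simp only [hQ0, Matrix.one_apply]
        split_ifs <;> norm_num) (by
        ext j
        simp [hQs, Matrix.mul_apply, Matrix.vecMul, dotProduct])
      have h7 : 0 < Q 1 7 7 := by
        have e : Q 1 7 = (cseq r 1)⁻¹ • ((Q 0 7) ᵥ* Pmat r 1) := by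
          ext j
          simp [hQs, Matrix.mul_apply, Matrix.vecMul, dotProduct]
        have e2 : (Q 0 7) ᵥ* Pmat r 1 = ((Q 0 7 ᵥ* Mmat) ᵥ* Amat ^ aseq r 2) ᵥ* Mmat := by
          simp [Pmat, ha, Matrix.vecMul_vecMul, Matrix.mul_assoc]
        obtain ⟨p, q, hA, -⟩ := Amat_pow (aseq r 2)
        rw [e, e2, hA, vecMul_Mmat, vecMul_Aexp, vecMul_Mmat, hQ0]
        simp [Matrix.one_apply, hc]
      have h8 : 0 ≤ Q 1 7 8 := hb.1 8
      unfold zed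
      have : 0 ≤ goldphi * Q 1 7 8 := mul_nonneg (by linarith) h8
      linarith
    have : 0 < Z 7 / (2 * goldphi) := div_pos h2 (by linarith)
    simp only [Pi.zero_apply] at h1
    linarith
  · rw [tendsto_pi_nhds]
    intro k
    refine (hZ k).congr ?_
    intro n
    rw [hQ]
    simp
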